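/- The dual norm of the overlapped S_∞/∞-norm ‖X‖ = max_k ‖X_(k)‖_{S∞} (maximum over modes of the spectral norm of the mode-k unfolding) is the latent Schatten 1-norm ‖W‖ = inf_{ΣW^(k)=W} Σ_k ‖W^(k)_(k)‖_{S1}. -/

import Mathlib

open scoped BigOperators

namespace TensorPaper

noncomputable def singularValues {m p : Type*} [Fintype m] [Fintype p] [DecidableEq m]
    (A : Matrix m p ℝ) : m → ℝ :=
  fun i => Real.sqrt ((Matrix.isHermitian_mul_conjTranspose_self A).eigenvalues i)

noncomputable def nuclearNorm {m p : Type*} [Fintype m] [Fintype p] [DecidableEq m]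
    (A : Matrix m p ℝ) : ℝ := ∑ i, singularValues A i

noncomputable def spectralNorm {m p : Type*} [Fintype m] [Fintype p] [DecidableEq m]
    (A : Matrix m p ℝ) : ℝ := ⨆ i, singularValues A i

noncomputable def frobM {m p : Type*} [Fintype m] [Fintype p]
    (A : Matrix m p ℝ) : ℝ := Real.sqrt (∑ i, ∑ j, A i j ^ 2)

variable {K : ℕ}

abbrev Tensor (n : Fin K → ℕ) : Type := (∀ j, Fin (n j)) → ℝ

noncomputable def unfoldT (n : Fin K → ℕ) (k : Fin K) (W : Tensor n) :
    Matrix (Fin (n k)) (∀ j : {j : Fin K // j ≠ k}, Fin (n j.1)) ℝ :=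
  fun i rest => W (fun j => if h : j = k then Fin.cast (congrArg n h.symm) i else rest ⟨j, h⟩)

noncomputable def frobT (n : Fin K → ℕ) (W : Tensor n) : ℝ :=
  Real.sqrt (∑ x, W x ^ 2)

noncomputable def tdot (n : Fin K → ℕ) (W X : Tensor n) : ℝ := ∑ x, W x * X x

noncomputable def latentNorm (n : Fin K → ℕ) (W : Tensor n) : ℝ :=
  sInf {s | ∃ Ws : Fin K → Tensor n,
    (∑ k, Ws k) = W ∧ s = ∑ k, nuclearNorm (unfoldT n k (Ws k))}

noncomputable def overlapSup (n : Fin K → ℕ) (X : Tensor n) : ℝ :=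
  ⨆ k, spectralNorm (unfoldT n k X)

/-- Matrix inner product. -/
noncomputable def mdot {m p : Type*} [Fintype m] [Fintype p] (A B : Matrix m p ℝ) : ℝ :=
  ∑ i, ∑ j, A i j * B i j

/-- `B` is a contraction. -/
def SC {m p : Type*} [Fintype m] [Fintype p] (B : Matrix m p ℝ) : Prop :=
  ∀ u : m → ℝ, dotProduct (Matrix.vecMul u B) (Matrix.vecMul u B) ≤ dotProduct u u

section mat
open Matrix
variable {m p : Type*} [Fintype m] [Fintype p] [DecidableEq m]

lemma mdot_eq (A B : Matrix m p ℝ) : mdot A B = (A * Bᵀ).trace := by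
  simp [mdot, Matrix.trace, Matrix.mul_apply]

lemma exists_diag (A : Matrix m p ℝ) : ∃ (U : Matrix m m ℝ) (l : m → ℝ),
    U * Uᵀ = 1 ∧ Uᵀ * U = 1 ∧ (Uᵀ * A) * (Uᵀ * A)ᵀ = diagonal l ∧ (∀ i, 0 ≤ l i) ∧
    singularValues A = fun i => Real.sqrt (l i) := by
  set hA := Matrix.isHermitian_mul_conjTranspose_self A with hAdef
  have h1 : (hA.eigenvectorUnitary : Matrix m m ℝ) * (hA.eigenvectorUnitary : Matrix m m ℝ)ᵀ = 1 := by
    have := (Matrix.mem_unitaryGroup_iff).1 hA.eigenvectorUnitary.2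
    simpa [star_eq_conjTranspose] using this
  have h2 : (hA.eigenvectorUnitary : Matrix m m ℝ)ᵀ * (hA.eigenvectorUnitary : Matrix m m ℝ) = 1 := by
    have := (Matrix.mem_unitaryGroup_iff').1 hA.eigenvectorUnitary.2
    simpa [star_eq_conjTranspose] using this
  refine ⟨hA.eigenvectorUnitary, hA.eigenvalues, h1, h2, ?_, ?_, rfl⟩
  · have h3 := hA.spectral_theorem
    set U := (hA.eigenvectorUnitary : Matrix m m ℝ) with hU
    have h4 : A * Aᵀ = U * diagonal hA.eigenvalues * Uᵀ := by
      rw [Unitary.conjStarAlgAut_apply, star_eq_conjTranspose] at h3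
      simp only [Matrix.conjTranspose_eq_transpose_of_trivial] at h3
      exact h3
    calc (Uᵀ * A) * (Uᵀ * A)ᵀ = Uᵀ * (A * Aᵀ) * U := by
          simp [Matrix.transpose_mul, Matrix.mul_assoc]
      _ = (Uᵀ * U) * diagonal hA.eigenvalues * (Uᵀ * U) := by
          rw [h4]; simp only [Matrix.mul_assoc]
      _ = _ := by rw [h2]; simp
  · exact (Matrix.posSemidef_self_mul_conjTranspose A).eigenvalues_nonneg

lemma vecMul_dot (u : m → ℝ) (B : Matrix m p ℝ) :
    (u ᵥ* B) ⬝ᵥ (u ᵥ* B) = u ᵥ* (B * Bᵀ) ⬝ᵥ u := by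
  rw [← Matrix.vecMul_vecMul, ← Matrix.dotProduct_mulVec (u ᵥ* B) Bᵀ u, Matrix.mulVec_transpose]

lemma orth_dot {U : Matrix m m ℝ} (h : U * Uᵀ = 1) (u : m → ℝ) :
    (u ᵥ* U) ⬝ᵥ (u ᵥ* U) = u ⬝ᵥ u := by
  rw [vecMul_dot, h, Matrix.vecMul_one]

lemma quad_diag {U : Matrix m m ℝ} {A : Matrix m p ℝ} {l : m → ℝ} (h : U * Uᵀ = 1)
    (hd : (Uᵀ * A) * (Uᵀ * A)ᵀ = diagonal l) (u : m → ℝ) :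
    (u ᵥ* A) ⬝ᵥ (u ᵥ* A) = ∑ i, (u ᵥ* U) i ^ 2 * l i := by
  have : u ᵥ* A = (u ᵥ* U) ᵥ* (Uᵀ * A) := by
    rw [Matrix.vecMul_vecMul, ← Matrix.mul_assoc, h, Matrix.one_mul]
  rw [this, vecMul_dot, hd]
  simp only [dotProduct, Matrix.vecMul_diagonal]
  exact Finset.sum_congr rfl fun i _ => by ring

lemma SC_of_spec {B : Matrix m p ℝ} (h : spectralNorm B ≤ 1) : SC B := by
  obtain ⟨U, l, h1, h2, hd, hl, hs⟩ := exists_diag B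
  intro u
  rw [quad_diag h1 hd, ← orth_dot h1 u]
  unfold dotProduct
  refine Finset.sum_le_sum fun i _ => ?_
  have : Real.sqrt (l i) ≤ 1 := by
    have h3 : singularValues B i ≤ spectralNorm B :=
      le_ciSup (f := singularValues B) (Set.finite_range _).bddAbove i
    rw [hs] at h3
    exact h3.trans h
  have h5 : l i ≤ 1 := by rwa [Real.sqrt_le_one] at this
  nlinarith [sq_nonneg ((u ᵥ* U) i)]

lemma row_dot (C : Matrix m p ℝ) (i : m) : C i ⬝ᵥ C i = (C * Cᵀ) i i := by
  simp [dotProduct, Matrix.mul_apply]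

lemma single_row (U : Matrix m m ℝ) (B : Matrix m p ℝ) (i : m) : (Uᵀ * B) i = Uᵀ i ᵥ* B := by
  ext j; simp [Matrix.mul_apply, Matrix.vecMul, dotProduct]

lemma SC_row {U : Matrix m m ℝ} (h : Uᵀ * U = 1) {B : Matrix m p ℝ} (hB : SC B) (i : m) :
    (Uᵀ * B) i ⬝ᵥ (Uᵀ * B) i ≤ 1 := by
  have := hB (Uᵀ i)
  rw [row_dot Uᵀ i, Matrix.transpose_transpose, h, Matrix.one_apply_eq, ← single_row] at this
  exact this

lemma spec_of_SC {B : Matrix m p ℝ} (h : SC B) : spectralNorm B ≤ 1 := by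
  obtain ⟨U, l, h1, h2, hd, hl, hs⟩ := exists_diag B
  refine Real.iSup_le (fun i => ?_) zero_le_one
  rw [hs]
  have := SC_row h2 h i
  rw [row_dot, hd, Matrix.diagonal_apply_eq] at this
  exact Real.sqrt_le_one.2 this

lemma dot_cs (v w : p → ℝ) : v ⬝ᵥ w ≤ Real.sqrt (v ⬝ᵥ v) * Real.sqrt (w ⬝ᵥ w) := by
  have := Real.sum_mul_le_sqrt_mul_sqrt Finset.univ v w
  simpa [dotProduct, sq] using this

lemma mdot_le {A B : Matrix m p ℝ} (hB : SC B) : mdot A B ≤ nuclearNorm A := by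
  obtain ⟨U, l, h1, h2, hd, hl, hs⟩ := exists_diag A
  have : mdot A B = mdot (Uᵀ * A) (Uᵀ * B) := by
    rw [mdot_eq, mdot_eq, Matrix.transpose_mul, Matrix.transpose_transpose, Matrix.mul_assoc,
      Matrix.trace_mul_comm Uᵀ, Matrix.mul_assoc, Matrix.mul_assoc, h1, Matrix.mul_one]
  rw [this, nuclearNorm, hs]
  refine Finset.sum_le_sum fun i _ => ?_
  refine (dot_cs ((Uᵀ * A) i) ((Uᵀ * B) i)).trans ?_
  rw [row_dot (Uᵀ * A), hd, Matrix.diagonal_apply_eq]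
  exact mul_le_of_le_one_right (Real.sqrt_nonneg _) (Real.sqrt_le_one.2 (SC_row h2 hB i))

lemma exists_mdot (A : Matrix m p ℝ) : ∃ B, SC B ∧ mdot A B = nuclearNorm A := by
  obtain ⟨U, l, h1, h2, hd, hl, hs⟩ := exists_diag A
  refine ⟨U * (diagonal (fun i => (Real.sqrt (l i))⁻¹) * (Uᵀ * A)), ?_, ?_⟩
  · intro u
    rw [← Matrix.vecMul_vecMul, ← orth_dot h1 u, vecMul_dot, Matrix.transpose_mul,
      Matrix.mul_assoc, ← Matrix.mul_assoc (Uᵀ * A), hd, Matrix.diagonal_transpose,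
      Matrix.diagonal_mul_diagonal, Matrix.diagonal_mul_diagonal]
    simp only [dotProduct, Matrix.vecMul_diagonal]
    refine Finset.sum_le_sum fun i _ => ?_
    have h5 : (Real.sqrt (l i))⁻¹ * (l i * (Real.sqrt (l i))⁻¹) ≤ 1 := by
      by_cases h0 : Real.sqrt (l i) = 0
      · simp [h0]
      · nth_rw 2 [← Real.mul_self_sqrt (hl i)]
        field_simp
        exact le_refl _
    nlinarith [mul_self_nonneg ((u ᵥ* U) i)]
  · rw [mdot_eq, Matrix.transpose_mul, Matrix.transpose_mul, ← Matrix.mul_assoc,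
      Matrix.trace_mul_comm, ← Matrix.mul_assoc, ← Matrix.mul_assoc, hd,
      Matrix.diagonal_transpose, Matrix.diagonal_mul_diagonal, Matrix.trace_diagonal,
      nuclearNorm, hs]
    refine Finset.sum_congr rfl fun i _ => ?_
    by_cases h0 : Real.sqrt (l i) = 0
    · simp [h0]
    · nth_rw 1 [← Real.mul_self_sqrt (hl i)]
      field_simp

lemma SC_of_le {B : Matrix m p ℝ} (h : ∀ A, mdot A B ≤ nuclearNorm A) : SC B := by
  intro u
  have key : ∀ C : Matrix m p ℝ,
      mdot (Matrix.of fun i j => u i * (u ᵥ* B) j) C = (u ᵥ* B) ⬝ᵥ (u ᵥ* C) := by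
    intro C
    simp only [mdot, Matrix.of_apply, dotProduct]
    rw [Finset.sum_comm]
    refine Finset.sum_congr rfl fun j _ => ?_
    have e : (u ᵥ* C) j = ∑ i, u i * C i j := rfl
    rw [e, Finset.mul_sum]
    exact Finset.sum_congr rfl fun i _ => by ring
  obtain ⟨C, hC, hCe⟩ := exists_mdot (Matrix.of fun i j => u i * (u ᵥ* B) j)
  have h1 := h (Matrix.of fun i j => u i * (u ᵥ* B) j)
  rw [← hCe, key, key] at h1
  have h2 := dot_cs (u ᵥ* B) (u ᵥ* C)
  have h3 := Real.sqrt_le_sqrt (hC u)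
  have h0 : 0 ≤ (u ᵥ* B) ⬝ᵥ (u ᵥ* B) := Finset.sum_nonneg fun i _ => mul_self_nonneg _
  have hu : 0 ≤ u ⬝ᵥ u := Finset.sum_nonneg fun i _ => mul_self_nonneg _
  set b := (u ᵥ* B) ⬝ᵥ (u ᵥ* B)
  have hb := Real.mul_self_sqrt h0
  have h4 : Real.sqrt b ≤ Real.sqrt (u ⬝ᵥ u) := by
    by_cases hz : Real.sqrt b = 0
    · rw [hz]; exact Real.sqrt_nonneg _
    · have hp : 0 < Real.sqrt b := lt_of_le_of_ne (Real.sqrt_nonneg _) (Ne.symm hz)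
      have : Real.sqrt b * Real.sqrt b ≤ Real.sqrt b * Real.sqrt (u ⬝ᵥ u) := by
        rw [hb]
        exact (h1.trans h2).trans (mul_le_mul_of_nonneg_left h3 hp.le)
      exact le_of_mul_le_mul_left this hp
  exact (Real.sqrt_le_sqrt_iff hu).1 h4

lemma nuc_nonneg (A : Matrix m p ℝ) : 0 ≤ nuclearNorm A :=
  Finset.sum_nonneg fun _ _ => Real.sqrt_nonneg _

lemma nuc_add (A B : Matrix m p ℝ) : nuclearNorm (A + B) ≤ nuclearNorm A + nuclearNorm B := by
  obtain ⟨C, hC, h⟩ := exists_mdot (A + B)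
  rw [← h]
  have : mdot (A + B) C = mdot A C + mdot B C := by
    simp [mdot, add_mul, Finset.sum_add_distrib]
  rw [this]
  exact add_le_add (mdot_le hC) (mdot_le hC)

lemma nuc_smul {c : ℝ} (hc : 0 < c) (A : Matrix m p ℝ) :
    nuclearNorm (c • A) ≤ c * nuclearNorm A := by
  obtain ⟨C, hC, h⟩ := exists_mdot (c • A)
  rw [← h]
  have : mdot (c • A) C = c * mdot A C := by
    simp [mdot, mul_assoc, Finset.mul_sum]
  rw [this]
  exact mul_le_mul_of_nonneg_left (mdot_le hC) hc.le

end mat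

lemma piSplit_symm (n : Fin K → ℕ) (k : Fin K) (W : Tensor n) (i r) :
    unfoldT n k W i r = W ((Equiv.piSplitAt k (fun j => Fin (n j))).symm (i, r)) := by
  unfold unfoldT
  congr 1
  funext j
  rw [Equiv.piSplitAt_symm_apply]
  by_cases h : j = k
  · subst h; simp
  · simp [h]

lemma tdot_unfold (n : Fin K → ℕ) (k : Fin K) (W X : Tensor n) :
    tdot n W X = mdot (unfoldT n k W) (unfoldT n k X) := by
  unfold mdot tdot
  simp only [piSplit_symm]
  rw [← Fintype.sum_prod_type' (f := fun i r =>
    W ((Equiv.piSplitAt k (fun j => Fin (n j))).symm (i, r)) *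
    X ((Equiv.piSplitAt k (fun j => Fin (n j))).symm (i, r)))]
  exact (Equiv.sum_comp (Equiv.piSplitAt k (fun j => Fin (n j))).symm (fun x => W x * X x)).symm

lemma unfold_surj (n : Fin K → ℕ) (k : Fin K) (A) : ∃ V : Tensor n, unfoldT n k V = A := by
  refine ⟨fun x => A (Equiv.piSplitAt k (fun j => Fin (n j)) x).1
    (Equiv.piSplitAt k (fun j => Fin (n j)) x).2, ?_⟩
  ext i r
  rw [piSplit_symm, Equiv.apply_symm_apply]

lemma latent_le (n : Fin K → ℕ) (Ws : Fin K → Tensor n) :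
    latentNorm n (∑ k, Ws k) ≤ ∑ k, nuclearNorm (unfoldT n k (Ws k)) := by
  refine csInf_le ⟨0, ?_⟩ ⟨Ws, rfl, rfl⟩
  rintro s ⟨V, -, rfl⟩
  exact Finset.sum_nonneg fun _ _ => nuc_nonneg _

lemma latent_set_ne (hK : 0 < K) (n : Fin K → ℕ) (W : Tensor n) :
    {s | ∃ Ws : Fin K → Tensor n,
    (∑ k, Ws k) = W ∧ s = ∑ k, nuclearNorm (unfoldT n k (Ws k))}.Nonempty :=
  ⟨_, Pi.single ⟨0, hK⟩ W, by simp, rfl⟩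

lemma latent_nonneg (n : Fin K → ℕ) (W : Tensor n) : 0 ≤ latentNorm n W := by
  refine Real.sInf_nonneg ?_
  rintro s ⟨V, -, rfl⟩
  exact Finset.sum_nonneg fun _ _ => nuc_nonneg _

lemma latent_approx (hK : 0 < K) (n : Fin K → ℕ) (W : Tensor n) {e : ℝ} (he : 0 < e) :
    ∃ Ws : Fin K → Tensor n, (∑ k, Ws k) = W ∧
      ∑ k, nuclearNorm (unfoldT n k (Ws k)) < latentNorm n W + e := by
  obtain ⟨s, ⟨Ws, h, rfl⟩, hs⟩ := exists_lt_of_csInf_lt (latent_set_ne hK n W)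
    (lt_add_of_pos_right (latentNorm n W) he)
  exact ⟨Ws, h, hs⟩

lemma latent_add (hK : 0 < K) (n : Fin K → ℕ) (V W : Tensor n) :
    latentNorm n (V + W) ≤ latentNorm n V + latentNorm n W := by
  refine le_of_forall_pos_le_add fun e he => ?_
  obtain ⟨Vs, rfl, h1⟩ := latent_approx hK n V (half_pos he)
  obtain ⟨Ws, rfl, h2⟩ := latent_approx hK n W (half_pos he)
  have h3 := latent_le n (fun k => Vs k + Ws k)
  rw [Finset.sum_add_distrib] at h3
  have h4 : ∑ k, nuclearNorm (unfoldT n k (Vs k + Ws k)) ≤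
      ∑ k, (nuclearNorm (unfoldT n k (Vs k)) + nuclearNorm (unfoldT n k (Ws k))) :=
    Finset.sum_le_sum fun k _ => nuc_add (unfoldT n k (Vs k)) (unfoldT n k (Ws k))
  rw [Finset.sum_add_distrib] at h4
  linarith

lemma latent_smul_le (hK : 0 < K) (n : Fin K → ℕ) {c : ℝ} (hc : 0 < c) (W : Tensor n) :
    latentNorm n (c • W) ≤ c * latentNorm n W := by
  refine le_of_forall_pos_le_add fun e he => ?_
  obtain ⟨Ws, rfl, h2⟩ := latent_approx hK n W (div_pos he hc)
  have h3 := latent_le n (fun k => c • Ws k)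
  rw [← Finset.smul_sum] at h3
  have h4 : ∑ k, nuclearNorm (unfoldT n k (c • Ws k)) ≤
      ∑ k, c * nuclearNorm (unfoldT n k (Ws k)) :=
    Finset.sum_le_sum fun k _ => nuc_smul hc (unfoldT n k (Ws k))
  rw [← Finset.mul_sum] at h4
  have h5 := mul_lt_mul_of_pos_left h2 hc
  rw [mul_add, mul_div_cancel₀ _ hc.ne'] at h5
  linarith

lemma latent_smul (hK : 0 < K) (n : Fin K → ℕ) (c : ℝ) (hc : 0 < c) (W : Tensor n) :
    latentNorm n (c • W) = c * latentNorm n W := by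
  refine le_antisymm (latent_smul_le hK n hc W) ?_
  have := latent_smul_le hK n (inv_pos.2 hc) (c • W)
  rw [inv_smul_smul₀ hc.ne', inv_mul_eq_div, le_div_iff₀ hc] at this
  linarith

lemma latent_single (n : Fin K → ℕ) (k : Fin K) (V : Tensor n) :
    latentNorm n V ≤ nuclearNorm (unfoldT n k V) := by
  have h := latent_le n (Pi.single k V)
  rw [Finset.sum_pi_single'] at h
  simp only [Finset.mem_univ, if_true] at h
  refine h.trans (le_of_eq ?_)
  rw [Finset.sum_eq_single k]
  · simp
  · intro j _ hj
    rw [Pi.single_eq_of_ne hj]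
    obtain ⟨C, -, hC⟩ := exists_mdot (unfoldT n j (0 : Tensor n))
    rw [← hC]
    simp [mdot, unfoldT]
  · simp

lemma exists_dual (hK : 0 < K) (n : Fin K → ℕ) (W : Tensor n) :
    ∃ X : Tensor n, overlapSup n X ≤ 1 ∧ latentNorm n W = tdot n W X := by
  have h0 : latentNorm n (0 : Tensor n) = 0 := by
    have := latent_smul hK n 2 two_pos 0
    rw [smul_zero] at this
    linarith
  obtain ⟨g, hg1, hg2⟩ : ∃ g : Tensor n →ₗ[ℝ] ℝ, g W = latentNorm n W ∧
      ∀ V, g V ≤ latentNorm n V := by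
    by_cases hW : W = 0
    · exact ⟨0, by rw [hW, h0]; rfl, fun V => latent_nonneg n V⟩
    · obtain ⟨g, h1, h2⟩ := exists_extension_of_le_sublinear
        (LinearPMap.mkSpanSingleton W (latentNorm n W) hW) (latentNorm n)
        (latent_smul hK n) (latent_add hK n) (by
          rintro ⟨x, hx⟩
          obtain ⟨c, rfl⟩ := Submodule.mem_span_singleton.1 hx
          have e := LinearPMap.mkSpanSingleton'_apply W (latentNorm n W) (fun c hc => by rw [(smul_eq_zero.1 hc).resolve_right hW, map_zero, zero_smul]) c hx
          refine (le_of_eq e).trans ?_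
          rw [smul_eq_mul]
          change c * latentNorm n W ≤ latentNorm n (c • W)
          rcases lt_trichotomy c 0 with h | h | h
          · exact (mul_nonpos_of_nonpos_of_nonneg h.le (latent_nonneg n W)).trans
              (latent_nonneg n _)
          · simp [h, h0]
          · rw [latent_smul hK n c h])
      refine ⟨g, ?_, h2⟩
      have := h1 ⟨W, Submodule.mem_span_singleton_self W⟩
      rw [this]
      exact LinearPMap.mkSpanSingleton_apply ℝ ℝ hW _
  have hX : ∀ V, g V = tdot n V (fun x => g (Pi.single x 1)) := by
    intro V
    rw [LinearMap.pi_apply_eq_sum_univ g V]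
    refine Finset.sum_congr rfl fun x _ => ?_
    rw [smul_eq_mul]
    congr 2
    funext y
    simp [Pi.single_apply, eq_comm]
  refine ⟨fun x => g (Pi.single x 1), ?_, ?_⟩
  · refine Real.iSup_le (fun k => spec_of_SC (SC_of_le fun A => ?_)) zero_le_one
    obtain ⟨V, rfl⟩ := unfold_surj n k A
    rw [← tdot_unfold, ← hX]
    exact (hg2 V).trans (latent_single n k V)
  · rw [← hX, hg1]

lemma tdot_le (hK : 0 < K) (n : Fin K → ℕ) (W X : Tensor n) (hX : overlapSup n X ≤ 1) :
    tdot n W X ≤ latentNorm n W := by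
  refine le_csInf (latent_set_ne hK n W) ?_
  rintro s ⟨Ws, rfl, rfl⟩
  have : tdot n (∑ k, Ws k) X = ∑ k, tdot n (Ws k) X := by
    simp only [tdot, Finset.sum_apply, Finset.sum_mul]
    exact Finset.sum_comm
  rw [this]
  refine Finset.sum_le_sum fun k _ => ?_
  rw [tdot_unfold n k]
  exact mdot_le (SC_of_spec ((le_ciSup (f := fun k => spectralNorm (unfoldT n k X))
    (Set.finite_range _).bddAbove k).trans hX))

theorem dual_of_overlap_sup_is_latentNorm {K : ℕ} (hK : 0 < K)
    (n : Fin K → ℕ) (W : Tensor n) :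
    sSup {s | ∃ X : Tensor n, overlapSup n X ≤ 1 ∧ s = tdot n W X} = latentNorm n W := by
  obtain ⟨X, hX, hXe⟩ := exists_dual hK n W
  refine IsGreatest.csSup_eq ⟨⟨X, hX, hXe⟩, ?_⟩
  rintro s ⟨Y, hY, rfl⟩
  exact tdot_le hK n W Y hY


end TensorPaper
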